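/- Let n ≥ 2, let A and B be n×n complex matrices that are Hermitian and positive definite, and let c > 0 and K > 0 be real constants such that tr(B⁻¹A) ≤ c and det(B) ≤ K · det(A). Then tr(A⁻¹B) ≤ c^{n−1} · K / n^{n−2}. -/

import Mathlib

open scoped ComplexOrder

/-- The tangent line inequality for `t ↦ t ^ (k + 1)` at `s`, cleared of subtractions. -/
lemma succ_mul_mul_pow_le (k : ℕ) {m s : ℝ} (hm : 0 ≤ m) (hs : 0 ≤ s) :
    (k + 1) * m * s ^ k ≤ m ^ (k + 1) + k * s ^ (k + 1) := by
  induction k with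
  | zero => simp
  | succ k ih =>
    have h₁ := mul_le_mul_of_nonneg_left ih hm
    have h₂ : 0 ≤ (k + 1) * s ^ k * (m - s) ^ 2 := by positivity
    push_cast
    ring_nf at h₁ h₂ ⊢
    linarith

/-- The AM-GM inequality together with the Maclaurin inequality between the first and the
second to last elementary symmetric functions, the latter written as `(∏ x) * ∑ x⁻¹`. -/
lemma prod_le_and_prod_mul_sum_inv_le {ι : Type*} (t : Finset ι) (x : ι → ℝ)
    (hx : ∀ i ∈ t, 0 < x i) :
    ∏ i ∈ t, x i ≤ ((∑ i ∈ t, x i) / t.card) ^ t.card ∧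
      (∏ i ∈ t, x i) * ∑ i ∈ t, (x i)⁻¹ ≤
        t.card * ((∑ i ∈ t, x i) / t.card) ^ (t.card - 1) := by
  classical
  induction t using Finset.induction_on with
  | empty => simp
  | insert a t ha ih =>
    obtain ⟨hprod, hinv⟩ := ih fun i hi => hx i (Finset.mem_insert_of_mem hi)
    have hxa : 0 < x a := hx a (Finset.mem_insert_self a t)
    have hsum : 0 ≤ ∑ i ∈ t, x i :=
      Finset.sum_nonneg fun i hi => (hx i (Finset.mem_insert_of_mem hi)).le
    rw [Finset.prod_insert ha, Finset.sum_insert ha, Finset.sum_insert ha,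
      Finset.card_insert_of_notMem ha, Nat.add_sub_cancel]
    rcases t.eq_empty_or_nonempty with rfl | ht
    · simp [hxa.ne']
    obtain ⟨k, hk⟩ : ∃ k, t.card = k + 1 := ⟨t.card - 1, by have := ht.card_pos; omega⟩
    rw [hk] at hprod hinv ⊢
    rw [Nat.add_sub_cancel] at hinv
    push_cast at hprod hinv ⊢
    set s := (∑ i ∈ t, x i) / ((k : ℝ) + 1) with hs
    set m := (x a + ∑ i ∈ t, x i) / ((k : ℝ) + 1 + 1) with hm
    have hs₀ : 0 ≤ s := by positivity
    have hm₀ : 0 ≤ m := by positivity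
    have hxm : x a = (k + 2) * m - (k + 1) * s := by
      rw [hs, hm]; field_simp; ring
    constructor
    · have h₁ := mul_le_mul_of_nonneg_left hprod hxa.le
      have h₂ := succ_mul_mul_pow_le (k + 1) hm₀ hs₀
      refine h₁.trans ?_
      rw [hxm]
      push_cast at h₂
      ring_nf at h₂ ⊢
      linarith
    · have h₁ := mul_le_mul_of_nonneg_left hinv hxa.le
      have h₂ := mul_le_mul_of_nonneg_left (succ_mul_mul_pow_le k hm₀ hs₀)
        (by positivity : (0 : ℝ) ≤ k + 2)
      have h₃ : x a * (∏ i ∈ t, x i) * ((x a)⁻¹ + ∑ i ∈ t, (x i)⁻¹) =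
          ∏ i ∈ t, x i + x a * ((∏ i ∈ t, x i) * ∑ i ∈ t, (x i)⁻¹) := by
        field_simp
      rw [h₃]
      refine (add_le_add hprod h₁).trans ?_
      rw [hxm]
      ring_nf at h₂ ⊢
      linarith

/-- The trace of the inverse of a positive definite matrix is the sum of the inverses of its
eigenvalues. -/
lemma Matrix.PosDef.trace_inv_eq_sum_inv_eigenvalues {ι : Type*} [Fintype ι] [DecidableEq ι]
    {M : Matrix ι ι ℂ} (hM : M.PosDef) :
    M⁻¹.trace = ∑ i, ((hM.1.eigenvalues i : ℂ))⁻¹ := by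
  set U : Matrix ι ι ℂ := (hM.1.eigenvectorUnitary).1
  set D : Matrix ι ι ℂ := Matrix.diagonal fun i => (hM.1.eigenvalues i : ℂ) with hD
  set E : Matrix ι ι ℂ := Matrix.diagonal fun i => (hM.1.eigenvalues i : ℂ)⁻¹ with hE
  have hUU : star U * U = 1 := Unitary.coe_star_mul_self hM.1.eigenvectorUnitary
  have hUU' : U * star U = 1 := Unitary.coe_mul_star_self hM.1.eigenvectorUnitary
  have hDE : D * E = 1 := by
    rw [hD, hE, Matrix.diagonal_mul_diagonal, ← Matrix.diagonal_one]
    congr 1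
    funext i
    exact mul_inv_cancel₀ (Complex.ofReal_ne_zero.mpr (hM.eigenvalues_pos i).ne')
  have hspec : M = U * D * star U := by
    have h := hM.1.spectral_theorem
    rw [Unitary.conjStarAlgAut_apply] at h
    exact h
  have hinv : M⁻¹ = U * E * star U := by
    apply Matrix.inv_eq_right_inv
    calc M * (U * E * star U) = U * D * (star U * U) * E * star U := by
          rw [hspec]; simp only [Matrix.mul_assoc]
      _ = 1 := by rw [hUU, Matrix.mul_one, Matrix.mul_assoc U, hDE, Matrix.mul_one, hUU']
  rw [hinv, Matrix.trace_mul_cycle, hUU, Matrix.one_mul, hE, Matrix.trace_diagonal]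

/-- The Maclaurin inequality for the eigenvalues of a positive definite matrix. -/
lemma Matrix.PosDef.det_mul_trace_inv_le {ι : Type*} [Fintype ι] [DecidableEq ι]
    {M : Matrix ι ι ℂ} (hM : M.PosDef) :
    M.det.re * M⁻¹.trace.re ≤
      Fintype.card ι * (M.trace.re / Fintype.card ι) ^ (Fintype.card ι - 1) := by
  have hdet : M.det = ((∏ i, hM.1.eigenvalues i : ℝ) : ℂ) := by
    simpa using hM.1.det_eq_prod_eigenvalues
  have htr : M.trace = ((∑ i, hM.1.eigenvalues i : ℝ) : ℂ) := by
    simpa using hM.1.trace_eq_sum_eigenvalues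
  have hinv : M⁻¹.trace = ((∑ i, (hM.1.eigenvalues i)⁻¹ : ℝ) : ℂ) := by
    simpa using hM.trace_inv_eq_sum_inv_eigenvalues
  rw [hdet, htr, hinv]
  simpa only [Complex.ofReal_re, Finset.card_univ] using
    (prod_le_and_prod_mul_sum_inv_le Finset.univ hM.1.eigenvalues
      fun i _ => hM.eigenvalues_pos i).2

open scoped Matrix MatrixOrder in
/-- For positive definite `A` and `B`, the matrix `B⁻¹ * A` is similar to a positive definite
matrix. -/
lemma Matrix.PosDef.exists_posDef_similar_inv_mul {ι : Type*} [Fintype ι] [DecidableEq ι]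
    {A B : Matrix ι ι ℂ} (hA : A.PosDef) (hB : B.PosDef) :
    ∃ M : Matrix ι ι ℂ, M.PosDef ∧ M.trace = (B⁻¹ * A).trace ∧
      M⁻¹.trace = (A⁻¹ * B).trace ∧ M.det * B.det = A.det := by
  obtain ⟨L, rfl⟩ : ∃ L : Matrix ι ι ℂ, A = Lᴴ * L := by
    exact CStarAlgebra.nonneg_iff_eq_star_mul_self.mp hA.posSemidef.nonneg
  have hL : IsUnit L := by
    have h := (Matrix.isUnit_iff_isUnit_det _).mp hA.isUnit
    rw [Matrix.det_mul] at h
    exact (Matrix.isUnit_iff_isUnit_det _).mpr (isUnit_of_mul_isUnit_right h)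
  have hBdet : IsUnit B.det := (Matrix.isUnit_iff_isUnit_det _).mp hB.isUnit
  refine ⟨L * B⁻¹ * Lᴴ, (Matrix.IsUnit.posDef_star_right_conjugate_iff hL).mpr hB.inv,
    ?_, ?_, ?_⟩
  · rw [Matrix.trace_mul_cycle, Matrix.trace_mul_comm]
  · rw [Matrix.mul_inv_rev, Matrix.mul_inv_rev, Matrix.mul_inv_rev,
      Matrix.nonsing_inv_nonsing_inv _ hBdet, ← Matrix.mul_assoc, Matrix.trace_mul_cycle]
  · have h : B⁻¹.det * B.det = 1 := by
      rw [← Matrix.det_mul, Matrix.nonsing_inv_mul _ hBdet, Matrix.det_one]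
    simp only [Matrix.det_mul]
    linear_combination L.det * Lᴴ.det * h

/-- Trace flip: for `n ≥ 2`, Hermitian positive definite complex matrices `A, B`,
and constants `c, K > 0` with `tr(B⁻¹A) ≤ c` and `det B ≤ K det A`, we have
`tr(A⁻¹B) ≤ c^{n-1} K / n^{n-2}`. -/
theorem trace_flip (n : ℕ) (hn : 2 ≤ n)
    (A B : Matrix (Fin n) (Fin n) ℂ) (hA : A.PosDef) (hB : B.PosDef)
    (c K : ℝ) (hc : 0 < c) (hK : 0 < K)
    (htr : (Matrix.trace (B⁻¹ * A)).re ≤ c)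
    (hdet : B.det.re ≤ K * A.det.re) :
    (Matrix.trace (A⁻¹ * B)).re ≤ c ^ (n - 1) * K / (n : ℝ) ^ (n - 2) := by
  obtain ⟨M, hM, hMtr, hMinv, hMdet⟩ := hA.exists_posDef_similar_inv_mul hB
  have hmac := hM.det_mul_trace_inv_le
  have hMtr₀ : 0 ≤ M.trace.re := (Complex.le_def.mp hM.posSemidef.trace_nonneg).1
  have hMinv₀ : 0 ≤ M⁻¹.trace.re := (Complex.le_def.mp hM.inv.posSemidef.trace_nonneg).1
  have hBdet := Complex.lt_def.mp hB.det_pos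
  have hdetre : M.det.re * B.det.re = A.det.re := by
    rw [← hMdet, Complex.mul_re, ← hBdet.2]; simp
  have hone : 1 ≤ K * M.det.re := by
    rw [← hdetre, ← mul_assoc] at hdet
    exact le_of_mul_le_mul_right (by simpa using hdet) hBdet.1
  rw [Fintype.card_fin] at hmac
  rw [← hMtr] at htr
  rw [← hMinv]
  obtain ⟨k, rfl⟩ := Nat.exists_eq_add_of_le' hn
  have hk : (0 : ℝ) < ((k + 2 : ℕ) : ℝ) := by positivity
  calc M⁻¹.trace.re ≤ K * M.det.re * M⁻¹.trace.re := le_mul_of_one_le_left hMinv₀ hone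
    _ = K * (M.det.re * M⁻¹.trace.re) := mul_assoc _ _ _
    _ ≤ K * (((k + 2 : ℕ) : ℝ) * (c / ((k + 2 : ℕ) : ℝ)) ^ (k + 2 - 1)) := by
        refine mul_le_mul_of_nonneg_left (hmac.trans ?_) hK.le
        gcongr
    _ = c ^ (k + 2 - 1) * K / ((k + 2 : ℕ) : ℝ) ^ (k + 2 - 2) := by
        rw [show k + 2 - 1 = k + 1 by omega, show k + 2 - 2 = k by omega, div_pow]
        field_simp
        ring
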